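/- arXiv:1609.07628 — 3 statements merged into one kernel-verified Lean document; each statement's English description precedes it below -/
import Mathlib

section
/- (Strict convexity of the energy, step 2 of the proof of Lemma 5.1) The functional 𝓔 is strictly convex on V: if u₁, u₂ ∈ V with u₁ ≠ u₂ (they differ at some point of D̄) and 0 < t < 1, then 𝓔(t·u₁ + (1−t)·u₂) < t·𝓔(u₁) + (1−t)·𝓔(u₂). -/
open MeasureTheory Set

noncomputable section

/-- The `x`-partial derivative of a function on `ℝ × ℝ`. -/
def pdx (v : ℝ × ℝ → ℝ) (p : ℝ × ℝ) : ℝ := fderiv ℝ v p (1, 0)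

/-- The `y`-partial derivative of a function on `ℝ × ℝ`. -/
def pdy (v : ℝ × ℝ → ℝ) (p : ℝ × ℝ) : ℝ := fderiv ℝ v p (0, 1)

/-- The squared norm of the (a.e.-defined) gradient `|∇v|²`. -/
def gradSq (v : ℝ × ℝ → ℝ) (p : ℝ × ℝ) : ℝ := (pdx v p) ^ 2 + (pdy v p) ^ 2

/-- The open domain `D = {(x,y) : φ(y) < x < 1, 0 < y < ε}`. -/
def Dom (ε : ℝ) (φ : ℝ → ℝ) : Set (ℝ × ℝ) :=
  {p | φ p.2 < p.1 ∧ p.1 < 1 ∧ 0 < p.2 ∧ p.2 < ε}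

/-- The closed strip `D̄ = {(x,y) : φ(y) ≤ x ≤ 1}`. -/
def DomBar (φ : ℝ → ℝ) : Set (ℝ × ℝ) := {p | φ p.2 ≤ p.1 ∧ p.1 ≤ 1}

/-- The admissible class `V`: Lipschitz functions on `D̄`, `ε`-periodic in `y`,
vanishing on `x = 1`. -/
def memV (ε : ℝ) (φ : ℝ → ℝ) (v : ℝ × ℝ → ℝ) : Prop :=
  (∃ K : NNReal, LipschitzOnWith K v (DomBar φ)) ∧
  (∀ x y : ℝ, v (x, y + ε) = v (x, y)) ∧
  (∀ y : ℝ, v (1, y) = 0)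

/-- The capillary energy functional `𝓔`. -/
def En (ε : ℝ) (φ c : ℝ → ℝ) (v : ℝ × ℝ → ℝ) : ℝ :=
  (1 / ε) * (∫ p in Dom ε φ, Real.sqrt (1 + gradSq v p)) -
  (1 / ε) * (∫ y in Ioo (0 : ℝ) ε,
    v (φ y, y) * c y * Real.sqrt (1 + (deriv φ y) ^ 2))

/-- First component of the field `∇v / √(1 + |∇v|²)`. -/
def F1 (v : ℝ × ℝ → ℝ) (p : ℝ × ℝ) : ℝ := pdx v p / Real.sqrt (1 + gradSq v p)

/-- Second component of the field `∇v / √(1 + |∇v|²)`. -/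
def F2 (v : ℝ × ℝ → ℝ) (p : ℝ × ℝ) : ℝ := pdy v p / Real.sqrt (1 + gradSq v p)

/-- A capillary solution: a member of `V`, `C²` on `D̄`, solving the minimal surface
equation in `D` and the contact-angle condition on the left boundary. -/
def IsCapillary (ε : ℝ) (φ c : ℝ → ℝ) (u : ℝ × ℝ → ℝ) : Prop :=
  memV ε φ u ∧ ContDiffOn ℝ 2 u (DomBar φ) ∧
  (∀ p ∈ Dom ε φ, pdx (F1 u) p + pdy (F2 u) p = 0) ∧
  (∀ y : ℝ, pdx u (φ y, y) - pdy u (φ y, y) * deriv φ y =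
    - c y * Real.sqrt (1 + gradSq u (φ y, y)) * Real.sqrt (1 + (deriv φ y) ^ 2))

/-- The `y`-average `v̄(x) = (1/ε) ∫₀^ε v(x,y) dy`. -/
def ybar (ε : ℝ) (v : ℝ × ℝ → ℝ) (x : ℝ) : ℝ := (1 / ε) * ∫ y in Ioo (0 : ℝ) ε, v (x, y)

/-- The cosine of the apparent contact angle,
`cos θₐ = (1/ε) ∫₀^ε c(y) √(1 + φ'(y)²) dy`. -/
def cosA (ε : ℝ) (φ c : ℝ → ℝ) : ℝ :=
  (1 / ε) * ∫ y in Ioo (0 : ℝ) ε, c y * Real.sqrt (1 + (deriv φ y) ^ 2)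

/-- The one-dimensional energy `E_β(w) = ∫₀¹ √(1 + w'(x)²) dx − β w(0)`. -/
def En1 (β : ℝ) (w : ℝ → ℝ) : ℝ :=
  (∫ x in Ioo (0 : ℝ) 1, Real.sqrt (1 + (deriv w x) ^ 2)) - w 0 * β

/-- The standard context hypotheses on the data `ε, ν, H, φ, c`. -/
def Ctx (ε ν H : ℝ) (φ c : ℝ → ℝ) : Prop :=
  ε ∈ Ioc (0 : ℝ) 1 ∧ ν ∈ Ico (0 : ℝ) 1 ∧ 0 ≤ H ∧
  ContDiff ℝ 1 φ ∧ (∀ y, φ (y + ε) = φ y) ∧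
  (∀ y, -(ε * H) ≤ φ y) ∧ (∀ y, φ y ≤ 0) ∧
  Continuous c ∧ (∀ y, c (y + ε) = c y) ∧
  (∀ y, |c y| * Real.sqrt (1 + (deriv φ y) ^ 2) ≤ ν)

lemma sqrt_convex_comb {t : ℝ} (ht : 0 < t) (ht1 : t < 1) (a b c d : ℝ) :
    √(1 + ((t * a + (1 - t) * b) ^ 2 + (t * c + (1 - t) * d) ^ 2)) ≤
      t * √(1 + (a ^ 2 + c ^ 2)) + (1 - t) * √(1 + (b ^ 2 + d ^ 2)) ∧
    (√(1 + ((t * a + (1 - t) * b) ^ 2 + (t * c + (1 - t) * d) ^ 2)) =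
      t * √(1 + (a ^ 2 + c ^ 2)) + (1 - t) * √(1 + (b ^ 2 + d ^ 2)) → a = b) := by
  have hA := Real.sq_sqrt (by positivity : (0 : ℝ) ≤ 1 + (a ^ 2 + c ^ 2))
  have hB := Real.sq_sqrt (by positivity : (0 : ℝ) ≤ 1 + (b ^ 2 + d ^ 2))
  have hC := Real.sq_sqrt (by positivity :
    (0 : ℝ) ≤ 1 + ((t * a + (1 - t) * b) ^ 2 + (t * c + (1 - t) * d) ^ 2))
  have hA0 := Real.sqrt_nonneg (1 + (a ^ 2 + c ^ 2))
  have hB0 := Real.sqrt_nonneg (1 + (b ^ 2 + d ^ 2))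
  set A := √(1 + (a ^ 2 + c ^ 2))
  set B := √(1 + (b ^ 2 + d ^ 2))
  have ht' : 0 < 1 - t := by linarith
  have hprod : (A * B) ^ 2 - (1 + a * b + c * d) ^ 2 =
      (a - b) ^ 2 + (c - d) ^ 2 + (a * d - b * c) ^ 2 := by
    rw [mul_pow, hA, hB]; ring
  have hdiff : (t * A + (1 - t) * B) ^ 2 -
      (1 + ((t * a + (1 - t) * b) ^ 2 + (t * c + (1 - t) * d) ^ 2)) =
      2 * t * (1 - t) * (A * B - (1 + a * b + c * d)) := by
    linear_combination t ^ 2 * hA + (1 - t) ^ 2 * hB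
  have hAB : 1 + a * b + c * d ≤ A * B := by
    apply le_of_sq_le_sq _ (by positivity)
    nlinarith [sq_nonneg (a - b), sq_nonneg (c - d), sq_nonneg (a * d - b * c)]
  refine ⟨?_, fun h => ?_⟩
  · apply Real.sqrt_le_iff.2 ⟨by positivity, ?_⟩
    have : 0 ≤ 2 * t * (1 - t) * (A * B - (1 + a * b + c * d)) :=
      mul_nonneg (by positivity) (by linarith)
    linarith
  · rw [h] at hC
    rw [hC, sub_self, eq_comm, mul_eq_zero] at hdiff
    have h0 : A * B = 1 + a * b + c * d := by
      rcases hdiff with h | h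
      · exact absurd h (by positivity)
      · linarith
    rw [h0, sub_self] at hprod
    nlinarith [sq_nonneg (a - b), sq_nonneg (c - d), sq_nonneg (a * d - b * c)]

lemma isOpen_Dom {ε : ℝ} {φ : ℝ → ℝ} (hφ : Continuous φ) : IsOpen (Dom ε φ) :=
  (isOpen_lt (hφ.comp continuous_snd) continuous_fst).inter <|
    (isOpen_lt continuous_fst continuous_const).inter <|
      (isOpen_lt continuous_const continuous_snd).inter (isOpen_lt continuous_snd continuous_const)

lemma Dom_subset_DomBar (ε : ℝ) (φ : ℝ → ℝ) : Dom ε φ ⊆ DomBar φ :=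
  fun _ hp => ⟨hp.1.le, hp.2.1.le⟩

lemma volume_Dom_lt_top {ε M : ℝ} {φ : ℝ → ℝ} (hM : ∀ y, M ≤ φ y) :
    volume (Dom ε φ) < ⊤ := by
  refine lt_of_le_of_lt (measure_mono (t := Icc (M, 0) (1, ε)) fun p hp => ?_)
    isCompact_Icc.measure_lt_top
  exact ⟨⟨(hM _).trans hp.1.le, hp.2.2.1.le⟩, hp.2.1.le, hp.2.2.2.le⟩

lemma ae_differentiableAt_Dom {ε : ℝ} {φ : ℝ → ℝ} (hφ : Continuous φ) {v : ℝ × ℝ → ℝ}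
    {K : NNReal} (hv : LipschitzOnWith K v (DomBar φ)) :
    ∀ᵐ p ∂volume.restrict (Dom ε φ), DifferentiableAt ℝ v p := by
  have hD := isOpen_Dom (ε := ε) hφ
  rw [ae_restrict_iff' hD.measurableSet]
  filter_upwards [(hv.mono (Dom_subset_DomBar ε φ)).ae_differentiableWithinAt_of_mem
    (μ := volume)] with p hp hpD
  exact (hp hpD).differentiableAt (hD.mem_nhds hpD)

lemma integrableOn_sqrt_gradSq {ε M : ℝ} {φ : ℝ → ℝ} (hφ : Continuous φ) (hM : ∀ y, M ≤ φ y)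
    {v : ℝ × ℝ → ℝ} {K : NNReal} (hv : LipschitzOnWith K v (DomBar φ)) :
    IntegrableOn (fun p => √(1 + gradSq v p)) (Dom ε φ) := by
  have hD := isOpen_Dom (ε := ε) hφ
  have hmeas : Measurable (fun p => √(1 + gradSq v p)) := by
    have h1 : Measurable (pdx v) := measurable_fderiv_apply_const ℝ v (1, 0)
    have h2 : Measurable (pdy v) := measurable_fderiv_apply_const ℝ v (0, 1)
    exact (measurable_const.add ((h1.pow_const 2).add (h2.pow_const 2))).sqrt
  refine Measure.integrableOn_of_bounded (M := √(1 + (K ^ 2 + K ^ 2)))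
    (volume_Dom_lt_top hM).ne hmeas.aestronglyMeasurable ?_
  filter_upwards [ae_restrict_mem hD.measurableSet] with p hp
  have hK : ‖fderiv ℝ v p‖ ≤ K := norm_fderiv_le_of_lipschitzOn ℝ (hD.mem_nhds hp)
    (hv.mono (Dom_subset_DomBar ε φ))
  have hx : |pdx v p| ≤ K := by
    simpa [pdx, Prod.norm_def] using (fderiv ℝ v p).le_of_opNorm_le hK (1, 0)
  have hy : |pdy v p| ≤ K := by
    simpa [pdy, Prod.norm_def] using (fderiv ℝ v p).le_of_opNorm_le hK (0, 1)
  rw [Real.norm_eq_abs, abs_of_nonneg (Real.sqrt_nonneg _)]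
  apply Real.sqrt_le_sqrt
  have h1 := sq_le_sq' (abs_le.1 hx).1 (abs_le.1 hx).2
  have h2 := sq_le_sq' (abs_le.1 hy).1 (abs_le.1 hy).2
  unfold gradSq
  linarith

lemma integrableOn_boundary {ε : ℝ} {φ c : ℝ → ℝ} (hφ : ContDiff ℝ 1 φ) (hφ0 : ∀ y, φ y ≤ 0)
    (hc : Continuous c) {v : ℝ × ℝ → ℝ} (hv : ContinuousOn v (DomBar φ)) :
    IntegrableOn (fun y => v (φ y, y) * c y * √(1 + (deriv φ y) ^ 2)) (Ioo 0 ε) := by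
  have h1 : Continuous (fun y => v (φ y, y)) :=
    hv.comp_continuous (hφ.continuous.prodMk continuous_id)
      fun y => ⟨le_rfl, (hφ0 y).trans zero_le_one⟩
  have h2 : Continuous (deriv φ) := hφ.continuous_deriv le_rfl
  have h3 : Continuous (fun y => v (φ y, y) * c y * √(1 + (deriv φ y) ^ 2)) :=
    (h1.mul hc).mul (continuous_const.add (h2.pow 2)).sqrt
  exact (h3.integrableOn_Icc (a := 0) (b := ε)).mono_set Ioo_subset_Icc_self

/-- A function on the strip whose `x`-derivative vanishes almost everywhere in `Dom` and which is
zero on the line `x = 1` is zero on the whole strip. -/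
lemma eqOn_zero_of_ae_pdx_eq_zero {ε : ℝ} (hε : 0 < ε) {φ : ℝ → ℝ} (hφ : Continuous φ)
    (hφ0 : ∀ y, φ y ≤ 0) (hφper : ∀ y, φ (y + ε) = φ y) {w : ℝ × ℝ → ℝ} (hw : memV ε φ w)
    (hdw : ∀ᵐ p ∂volume.restrict (Dom ε φ), pdx w p = 0) :
    ∀ p ∈ DomBar φ, w p = 0 := by
  obtain ⟨⟨K, hK⟩, hper, h1⟩ := hw
  have hD := isOpen_Dom (ε := ε) hφ
  have hae : ∀ᵐ p : ℝ × ℝ, p ∈ Dom ε φ → DifferentiableAt ℝ w p ∧ pdx w p = 0 :=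
    (ae_restrict_iff' hD.measurableSet).1 ((ae_differentiableAt_Dom hφ hK).and hdw)
  have hline : ∀ᵐ y : ℝ, ∀ᵐ x : ℝ, (x, y) ∈ Dom ε φ →
      DifferentiableAt ℝ w (x, y) ∧ pdx w (x, y) = 0 :=
    Measure.ae_ae_of_ae_prod
      (Measure.measurePreserving_swap (μ := (volume : Measure ℝ))
        (ν := (volume : Measure ℝ)).quasiMeasurePreserving.ae hae)
  have hzero : ∀ᵐ y : ℝ, y ∈ Ioo 0 ε → ∀ x, φ y ≤ x → x ≤ 1 → w (x, y) = 0 := by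
    filter_upwards [hline] with y hy hyε x hx hx1
    have hLip : LipschitzOnWith K (fun s => w (s, y)) (uIcc x 1) := by
      rw [uIcc_of_le hx1]
      refine LipschitzOnWith.of_dist_le_mul fun s hs s' hs' => ?_
      simpa [Prod.dist_eq] using hK.dist_le_mul (s, y) ⟨hx.trans hs.1, hs.2⟩ (s', y)
        ⟨hx.trans hs'.1, hs'.2⟩
    have hftc := hLip.absolutelyContinuousOnInterval.integral_deriv_eq_sub
    have hint : ∫ s in x..1, deriv (fun s => w (s, y)) s = 0 := by
      apply intervalIntegral.integral_zero_ae
      have hne1 : ∀ᵐ s : ℝ, s ≠ 1 := by simp [ae_iff]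
      filter_upwards [hy, hne1] with s hs hs1 hmem
      rw [uIoc_of_le hx1] at hmem
      obtain ⟨hd, hz⟩ := hs ⟨hx.trans_lt hmem.1, lt_of_le_of_ne hmem.2 hs1, hyε.1, hyε.2⟩
      have hcurve : HasDerivAt (fun s : ℝ => (s, y)) ((1 : ℝ), (0 : ℝ)) s :=
        (hasDerivAt_id s).prodMk (hasDerivAt_const s y)
      exact (hd.hasFDerivAt.comp_hasDerivAt s hcurve).deriv.trans hz
    rw [hint, h1] at hftc
    linarith
  have hIcc : ∀ x ≤ 1, ∀ y ∈ Icc 0 ε, w (max x (φ y), y) = 0 := by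
    intro x hx
    have hmem : ∀ y, (max x (φ y), y) ∈ DomBar φ := fun y =>
      ⟨le_max_right _ _, max_le hx ((hφ0 y).trans zero_le_one)⟩
    have hcont : Continuous (fun y => w (max x (φ y), y)) :=
      hK.continuousOn.comp_continuous (by fun_prop) hmem
    refine Measure.eqOn_Icc_of_ae_eq volume hε.ne ?_ hcont.continuousOn
      continuousOn_const (g := fun _ => 0)
    rw [← restrict_Ioo_eq_restrict_Icc]
    filter_upwards [ae_restrict_of_ae hzero, ae_restrict_mem measurableSet_Ioo] with y hy hyε
    exact hy hyε _ (hmem y).1 (hmem y).2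
  rintro ⟨x, y⟩ ⟨hx, hx1⟩
  obtain ⟨y', hy', hyy⟩ := Function.Periodic.exists_mem_Ico₀
    (f := fun y => (φ y, w (x, y))) (c := ε) (fun y => by simp [hφper, hper]) hε y
  simp only [Prod.mk.injEq] at hyy
  have := hIcc x hx1 y' (Ico_subset_Icc_self hy')
  rw [← hyy.1, max_eq_left hx, ← hyy.2] at this
  exact this

/-- Strict convexity of the energy functional `𝓔` on `V` (step 2 of the proof of
Lemma 5.1). -/
theorem energy_strictly_convex
    (ε ν H : ℝ) (φ c : ℝ → ℝ) (hctx : Ctx ε ν H φ c)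
    (u₁ u₂ : ℝ × ℝ → ℝ) (hu₁ : memV ε φ u₁) (hu₂ : memV ε φ u₂)
    (hne : ∃ p ∈ DomBar φ, u₁ p ≠ u₂ p)
    (t : ℝ) (ht : 0 < t) (ht1 : t < 1) :
    En ε φ c (fun p => t * u₁ p + (1 - t) * u₂ p) <
      t * En ε φ c u₁ + (1 - t) * En ε φ c u₂ := by
  obtain ⟨⟨hε, -⟩, -, -, hφ, hφper, hφM, hφ0, hc, -, -⟩ := hctx
  obtain ⟨⟨K₁, hK₁⟩, hper₁, hone₁⟩ := hu₁
  obtain ⟨⟨K₂, hK₂⟩, hper₂, hone₂⟩ := hu₂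
  have hφc := hφ.continuous
  set u : ℝ × ℝ → ℝ := fun p => t * u₁ p + (1 - t) * u₂ p with hu
  have hLip : ∃ K, LipschitzOnWith K u (DomBar φ) :=
    ⟨_, ((lipschitzWith_smul t).comp_lipschitzOnWith hK₁).add
      ((lipschitzWith_smul (1 - t)).comp_lipschitzOnWith hK₂)⟩
  obtain ⟨K, hK⟩ := hLip
  have hI := integrableOn_sqrt_gradSq (ε := ε) hφc hφM hK
  have hI₁ := integrableOn_sqrt_gradSq (ε := ε) hφc hφM hK₁
  have hI₂ := integrableOn_sqrt_gradSq (ε := ε) hφc hφM hK₂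
  have hbdry : ∫ y in Ioo (0 : ℝ) ε, u (φ y, y) * c y * √(1 + (deriv φ y) ^ 2) =
      t * (∫ y in Ioo (0 : ℝ) ε, u₁ (φ y, y) * c y * √(1 + (deriv φ y) ^ 2)) +
      (1 - t) * ∫ y in Ioo (0 : ℝ) ε, u₂ (φ y, y) * c y * √(1 + (deriv φ y) ^ 2) := by
    rw [← integral_const_mul, ← integral_const_mul, ← integral_add
      ((integrableOn_boundary hφ hφ0 hc hK₁.continuousOn).const_mul t)
      ((integrableOn_boundary hφ hφ0 hc hK₂.continuousOn).const_mul (1 - t))]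
    congr 1 with y
    simp only [hu]
    ring
  have hpd : ∀ᵐ p ∂volume.restrict (Dom ε φ),
      pdx u p = t * pdx u₁ p + (1 - t) * pdx u₂ p ∧
      pdy u p = t * pdy u₁ p + (1 - t) * pdy u₂ p := by
    filter_upwards [ae_differentiableAt_Dom hφc hK₁, ae_differentiableAt_Dom hφc hK₂]
      with p h₁ h₂
    have hf : fderiv ℝ u p = t • fderiv ℝ u₁ p + (1 - t) • fderiv ℝ u₂ p :=
      ((h₁.hasFDerivAt.const_mul t).add (h₂.hasFDerivAt.const_mul (1 - t))).fderiv
    simp [pdx, pdy, hf]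
  set G : ℝ × ℝ → ℝ := fun p =>
    t * √(1 + gradSq u₁ p) + (1 - t) * √(1 + gradSq u₂ p) - √(1 + gradSq u p) with hG
  have hI₁₂ := (hI₁.const_mul t).add (hI₂.const_mul (1 - t))
  have hGint : Integrable G (volume.restrict (Dom ε φ)) := hI₁₂.sub hI
  have hG0 : 0 ≤ᵐ[volume.restrict (Dom ε φ)] G := by
    filter_upwards [hpd] with p hp
    have := (sqrt_convex_comb ht ht1 (pdx u₁ p) (pdx u₂ p) (pdy u₁ p) (pdy u₂ p)).1
    rw [← hp.1, ← hp.2] at this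
    exact sub_nonneg.2 this
  have hGval : ∫ p in Dom ε φ, G p = t * (∫ p in Dom ε φ, √(1 + gradSq u₁ p)) +
      (1 - t) * (∫ p in Dom ε φ, √(1 + gradSq u₂ p)) - ∫ p in Dom ε φ, √(1 + gradSq u p) := by
    rw [← integral_const_mul, ← integral_const_mul,
      ← integral_add (hI₁.const_mul t) (hI₂.const_mul (1 - t))]
    exact integral_sub hI₁₂ hI
  have hGpos : 0 < ∫ p in Dom ε φ, G p := by
    refine lt_of_le_of_ne (integral_nonneg_of_ae hG0) fun h => ?_
    have hGz := (integral_eq_zero_iff_of_nonneg_ae hG0 hGint).1 h.symm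
    have hw : memV ε φ (fun p => u₁ p - u₂ p) :=
      ⟨⟨_, hK₁.sub hK₂⟩, fun x y => by simp only [hper₁, hper₂],
        fun y => by simp only [hone₁, hone₂, sub_self]⟩
    have hdw : ∀ᵐ p ∂volume.restrict (Dom ε φ), pdx (fun p => u₁ p - u₂ p) p = 0 := by
      filter_upwards [hpd, hGz, ae_differentiableAt_Dom hφc hK₁, ae_differentiableAt_Dom hφc hK₂]
        with p hp hz h₁ h₂
      have heq := (sqrt_convex_comb ht ht1 (pdx u₁ p) (pdx u₂ p) (pdy u₁ p) (pdy u₂ p)).2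
      rw [← hp.1, ← hp.2] at heq
      have hx := heq (sub_eq_zero.1 hz).symm
      have hf : fderiv ℝ (fun p => u₁ p - u₂ p) p = fderiv ℝ u₁ p - fderiv ℝ u₂ p :=
        (h₁.hasFDerivAt.sub h₂.hasFDerivAt).fderiv
      simpa [pdx, hf, sub_eq_zero] using hx
    obtain ⟨p, hp, hpne⟩ := hne
    exact hpne (sub_eq_zero.1
      (eqOn_zero_of_ae_pdx_eq_zero hε hφc hφ0 hφper hw hdw p hp))
  rw [hGval] at hGpos
  have := mul_pos (one_div_pos.2 hε) hGpos
  unfold En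
  rw [hbdry]
  linarith
end
end

section
/- (Translation estimate in the proof of Lemma 5.3) Let v ∈ V and 0 < δ ≤ 1. Define the translated function T_δv on D̄ by T_δv(x,y) = v(x+δ, y) for φ(y) ≤ x ≤ 1−δ and T_δv(x,y) = 0 for 1−δ ≤ x ≤ 1. Then T_δv ∈ V and 𝓔(v) − 𝓔(T_δv) ≥ (1−ν)·(1/ε)∫₀^ε ∫_{φ(y)}^{φ(y)+δ} √(1+|∇v(x,y)|²) dx dy − δ. -/
open MeasureTheory Set

noncomputable section

lemma isOpen_strip {φ : ℝ → ℝ} (hφ : Continuous φ) :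
    IsOpen {p : ℝ × ℝ | φ p.2 < p.1 ∧ p.1 < 1} :=
  (isOpen_lt (hφ.comp continuous_snd) continuous_fst).inter
    (isOpen_lt continuous_fst continuous_const)

lemma domBar_mem_nhds {φ : ℝ → ℝ} (hφ : Continuous φ) {p : ℝ × ℝ}
    (h1 : φ p.2 < p.1) (h2 : p.1 < 1) : DomBar φ ∈ nhds p := by
  filter_upwards [(isOpen_strip hφ).mem_nhds ⟨h1, h2⟩] with q hq
  exact ⟨hq.1.le, hq.2.le⟩

lemma measurable_sqrt_gradSq (v : ℝ × ℝ → ℝ) :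
    Measurable fun p => Real.sqrt (1 + gradSq v p) := by
  have hx : Measurable (pdx v) := measurable_fderiv_apply_const ℝ v (1, 0)
  have hy : Measurable (pdy v) := measurable_fderiv_apply_const ℝ v (0, 1)
  exact (((hx.pow_const 2).add (hy.pow_const 2)).const_add 1).sqrt

lemma exists_sqrt_gradSq_le {ε : ℝ} {φ : ℝ → ℝ} (hφ : Continuous φ) {v : ℝ × ℝ → ℝ}
    (hv : memV ε φ v) :
    ∃ C : ℝ, ∀ p : ℝ × ℝ, φ p.2 < p.1 → p.1 < 1 → Real.sqrt (1 + gradSq v p) ≤ C := by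
  obtain ⟨⟨K, hK⟩, -, -⟩ := hv
  refine ⟨Real.sqrt (1 + ((K : ℝ) ^ 2 + (K : ℝ) ^ 2)), fun p h1 h2 => Real.sqrt_le_sqrt ?_⟩
  have hn : ‖fderiv ℝ v p‖ ≤ K := norm_fderiv_le_of_lipschitzOn ℝ (domBar_mem_nhds hφ h1 h2) hK
  have hdir : ∀ e : ℝ × ℝ, ‖e‖ ≤ 1 → (fderiv ℝ v p e) ^ 2 ≤ (K : ℝ) ^ 2 := fun e he => by
    have := (fderiv ℝ v p).le_of_opNorm_le_of_le hn he
    rw [mul_one, Real.norm_eq_abs] at this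
    exact sq_le_sq' (by linarith [abs_le.1 this]) (abs_le.1 this).2
  have hx : (pdx v p) ^ 2 ≤ (K : ℝ) ^ 2 := hdir (1, 0) (by simp [Prod.norm_def])
  have hy : (pdy v p) ^ 2 ≤ (K : ℝ) ^ 2 := hdir (0, 1) (by simp [Prod.norm_def])
  unfold gradSq
  linarith

lemma abs_pdx_le_sqrt_gradSq (v : ℝ × ℝ → ℝ) (p : ℝ × ℝ) :
    |pdx v p| ≤ Real.sqrt (1 + gradSq v p) := by
  apply Real.abs_le_sqrt
  unfold gradSq
  nlinarith [sq_nonneg (pdy v p)]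

lemma memV_translate {ε : ℝ} {φ : ℝ → ℝ} {v : ℝ × ℝ → ℝ} (hv : memV ε φ v)
    {δ : ℝ} (hδ : 0 < δ) {Tv : ℝ × ℝ → ℝ}
    (hTv : ∀ p : ℝ × ℝ, Tv p = if p.1 ≤ 1 - δ then v (p.1 + δ, p.2) else 0) :
    memV ε φ Tv := by
  obtain ⟨⟨K, hK⟩, hper, h0⟩ := hv
  refine ⟨⟨K, ?_⟩, fun x y => by simp only [hTv, hper], fun y => ?_⟩
  · have key : ∀ p ∈ DomBar φ, ∀ q ∈ DomBar φ, p.1 ≤ 1 - δ → ¬ q.1 ≤ 1 - δ →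
        dist (Tv p) (Tv q) ≤ K * dist p q := fun p hp q hq h1 h2 => by
      rw [hTv p, hTv q, if_pos h1, if_neg h2, ← h0 p.2]
      refine (hK.dist_le_mul (p.1 + δ, p.2) ⟨by simp only; linarith [hp.1], by simp only; linarith⟩
        (1, p.2) ⟨by simp only; linarith [hp.1, hp.2], le_refl _⟩).trans ?_
      refine mul_le_mul_of_nonneg_left ?_ K.coe_nonneg
      rw [Prod.dist_eq, Prod.dist_eq]
      refine le_max_of_le_left (max_le ?_ (by simp))
      simp only [Real.dist_eq]
      push Not at h2
      rw [abs_of_nonpos (by linarith), abs_of_nonpos (by linarith)]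
      linarith
    refine LipschitzOnWith.of_dist_le_mul fun p hp q hq => ?_
    by_cases h1 : p.1 ≤ 1 - δ <;> by_cases h2 : q.1 ≤ 1 - δ
    · rw [hTv p, hTv q, if_pos h1, if_pos h2]
      refine (hK.dist_le_mul (p.1 + δ, p.2) ⟨by simp only; linarith [hp.1], by simp only; linarith⟩
        (q.1 + δ, q.2) ⟨by simp only; linarith [hq.1], by simp only; linarith⟩).trans_eq ?_
      simp [Prod.dist_eq]
    · exact key p hp q hq h1 h2
    · rw [dist_comm, dist_comm p]
      exact key q hq p hp h2 h1
    · rw [hTv p, hTv q, if_neg h1, if_neg h2, dist_self]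
      positivity
  · rw [hTv, if_neg]
    simp only
    linarith

lemma gradSq_translate_left {v Tv : ℝ × ℝ → ℝ} {δ : ℝ}
    (hTv : ∀ p : ℝ × ℝ, Tv p = if p.1 ≤ 1 - δ then v (p.1 + δ, p.2) else 0)
    {x y : ℝ} (hx : x < 1 - δ) : gradSq Tv (x, y) = gradSq v (x + δ, y) := by
  have h : Tv =ᶠ[nhds (x, y)] fun p => v (p + (δ, 0)) := by
    filter_upwards [(isOpen_lt continuous_fst continuous_const).mem_nhds
      (show ((x, y) : ℝ × ℝ).1 < 1 - δ from hx)] with p hp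
    rw [hTv, if_pos (le_of_lt hp)]
    congr 1
    ext <;> simp
  have h2 : fderiv ℝ Tv (x, y) = fderiv ℝ v (x + δ, y) := by
    rw [h.fderiv_eq, fderiv_comp_add_right]
    simp
  simp only [gradSq, pdx, pdy, h2]

lemma gradSq_translate_right {v Tv : ℝ × ℝ → ℝ} {δ : ℝ}
    (hTv : ∀ p : ℝ × ℝ, Tv p = if p.1 ≤ 1 - δ then v (p.1 + δ, p.2) else 0)
    {x y : ℝ} (hx : 1 - δ < x) : gradSq Tv (x, y) = 0 := by
  have h : Tv =ᶠ[nhds (x, y)] fun _ => (0 : ℝ) := by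
    filter_upwards [(isOpen_lt continuous_const continuous_fst).mem_nhds
      (show 1 - δ < ((x, y) : ℝ × ℝ).1 from hx)] with p hp
    rw [hTv, if_neg (not_le.2 hp)]
  have h2 : fderiv ℝ Tv (x, y) = 0 := by
    rw [h.fderiv_eq]
    simp
  simp [gradSq, pdx, pdy, h2]

lemma intervalIntegrable_slice {ε : ℝ} {φ : ℝ → ℝ} (hφ : Continuous φ) {v : ℝ × ℝ → ℝ}
    (hv : memV ε φ v) {y a b : ℝ} (ha : φ y ≤ a) (hab : a ≤ b) (hb : b ≤ 1) :
    IntervalIntegrable (fun x => Real.sqrt (1 + gradSq v (x, y))) volume a b := by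
  obtain ⟨C, hC⟩ := exists_sqrt_gradSq_le hφ hv
  rw [intervalIntegrable_iff_integrableOn_Ioo_of_le hab]
  refine IntegrableOn.of_bound (by simp)
    ((measurable_sqrt_gradSq v).comp measurable_prodMk_right).aestronglyMeasurable C ?_
  filter_upwards [ae_restrict_mem measurableSet_Ioo] with x hx
  rw [Real.norm_of_nonneg (Real.sqrt_nonneg _)]
  exact hC (x, y) (ha.trans_lt hx.1) (hx.2.trans_le hb)

lemma integral_slice_translate {ε : ℝ} {φ : ℝ → ℝ} (hφ : Continuous φ)
    {v : ℝ × ℝ → ℝ} (hv : memV ε φ v) {δ : ℝ} (hδ : 0 < δ) {Tv : ℝ × ℝ → ℝ}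
    (hTv : ∀ p : ℝ × ℝ, Tv p = if p.1 ≤ 1 - δ then v (p.1 + δ, p.2) else 0)
    {y : ℝ} (hy : φ y ≤ 1 - δ) :
    ∫ x in φ y..1, Real.sqrt (1 + gradSq Tv (x, y)) =
      (∫ x in (φ y + δ)..1, Real.sqrt (1 + gradSq v (x, y))) + δ := by
  have hT := memV_translate hv hδ hTv
  rw [← intervalIntegral.integral_add_adjacent_intervals
    (intervalIntegrable_slice hφ hT le_rfl hy (by linarith))
    (intervalIntegrable_slice hφ hT hy (by linarith) le_rfl)]
  congr 1
  · have : ∫ x in φ y..(1 - δ), Real.sqrt (1 + gradSq Tv (x, y)) =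
        ∫ x in φ y..(1 - δ), Real.sqrt (1 + gradSq v (x + δ, y)) := by
      rw [intervalIntegral.integral_of_le hy, intervalIntegral.integral_of_le hy,
        integral_Ioc_eq_integral_Ioo, integral_Ioc_eq_integral_Ioo]
      refine setIntegral_congr_fun measurableSet_Ioo fun x hx => ?_
      simp only [gradSq_translate_left hTv hx.2]
    rw [this, intervalIntegral.integral_comp_add_right
      (fun x => Real.sqrt (1 + gradSq v (x, y))) δ, sub_add_cancel]
  · have : ∫ x in (1 - δ)..1, Real.sqrt (1 + gradSq Tv (x, y)) = ∫ _ in (1 - δ)..1, (1 : ℝ) := by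
      rw [intervalIntegral.integral_of_le (by linarith), intervalIntegral.integral_of_le (by linarith)]
      refine setIntegral_congr_fun measurableSet_Ioc fun x hx => ?_
      simp [gradSq_translate_right hTv hx.1]
    rw [this]
    simp

lemma ae_abs_sub_le_integral_slice {ε : ℝ} {φ : ℝ → ℝ} (hφ : Continuous φ)
    {v : ℝ × ℝ → ℝ} (hv : memV ε φ v) :
    ∀ᵐ y : ℝ, ∀ a b : ℝ, φ y ≤ a → a ≤ b → b ≤ 1 →
      |v (a, y) - v (b, y)| ≤ ∫ x in a..b, Real.sqrt (1 + gradSq v (x, y)) := by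
  obtain ⟨K, hK⟩ := hv.1
  have hae : ∀ᵐ p : ℝ × ℝ, p ∈ DomBar φ → DifferentiableWithinAt ℝ v (DomBar φ) p :=
    hK.ae_differentiableWithinAt_of_mem
  rw [Measure.volume_eq_prod] at hae
  have hae' := Measure.ae_ae_of_ae_prod
    ((Measure.measurePreserving_swap (μ := (volume : Measure ℝ))
      (ν := (volume : Measure ℝ))).quasiMeasurePreserving.ae hae)
  filter_upwards [hae'] with y hy a b ha hab hb
  have hLip : LipschitzOnWith K (fun x => v (x, y)) (uIcc a b) := by
    rw [uIcc_of_le hab]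
    refine LipschitzOnWith.of_dist_le_mul fun s hs t ht => ?_
    refine (hK.dist_le_mul (s, y) ⟨ha.trans hs.1, hs.2.trans hb⟩
      (t, y) ⟨ha.trans ht.1, ht.2.trans hb⟩).trans_eq ?_
    simp [Prod.dist_eq]
  rw [abs_sub_comm, ← hLip.absolutelyContinuousOnInterval.integral_deriv_eq_sub]
  have hint := hLip.absolutelyContinuousOnInterval.intervalIntegrable_deriv
  refine (intervalIntegral.abs_integral_le_integral_abs hab).trans ?_
  rw [intervalIntegral.integral_of_le hab, intervalIntegral.integral_of_le hab,
    integral_Ioc_eq_integral_Ioo, integral_Ioc_eq_integral_Ioo]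
  refine integral_mono_ae
    ((intervalIntegrable_iff_integrableOn_Ioo_of_le hab).1 hint.abs)
    ((intervalIntegrable_iff_integrableOn_Ioo_of_le hab).1
      (intervalIntegrable_slice hφ hv ha hab hb)) ?_
  filter_upwards [ae_restrict_of_ae hy, ae_restrict_mem measurableSet_Ioo] with x hx hxI
  have h1 : φ y < x := ha.trans_lt hxI.1
  have h2 : x < 1 := hxI.2.trans_le hb
  have hd : DifferentiableAt ℝ v (x, y) :=
    (hx ⟨h1.le, h2.le⟩).differentiableAt (domBar_mem_nhds hφ h1 h2)
  have hderiv : HasDerivAt (fun s => v (s, y)) (pdx v (x, y)) x :=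
    hd.hasFDerivAt.comp_hasDerivAt x ((hasDerivAt_id x).prodMk (hasDerivAt_const x y))
  simp only [hderiv.deriv]
  exact abs_pdx_le_sqrt_gradSq v (x, y)

lemma measurableSet_dom {ε : ℝ} {φ : ℝ → ℝ} (hφ : Continuous φ) : MeasurableSet (Dom ε φ) := by
  have : Dom ε φ = {p : ℝ × ℝ | φ p.2 < p.1 ∧ p.1 < 1} ∩ Prod.snd ⁻¹' Ioo 0 ε := by
    ext p
    simp [Dom, and_assoc]
  rw [this]
  exact (isOpen_strip hφ).measurableSet.inter (measurable_snd measurableSet_Ioo)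

lemma integrableOn_dom {ε H : ℝ} {φ : ℝ → ℝ} (hφ : Continuous φ) (hH : ∀ y, -(ε * H) ≤ φ y)
    {v : ℝ × ℝ → ℝ} (hv : memV ε φ v) :
    IntegrableOn (fun p => Real.sqrt (1 + gradSq v p)) (Dom ε φ) := by
  obtain ⟨C, hC⟩ := exists_sqrt_gradSq_le hφ hv
  have hsub : Dom ε φ ⊆ Icc (-(ε * H)) 1 ×ˢ Icc 0 ε := fun p hp =>
    ⟨⟨(hH _).trans hp.1.le, hp.2.1.le⟩, ⟨hp.2.2.1.le, hp.2.2.2.le⟩⟩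
  refine IntegrableOn.of_bound ((measure_mono hsub).trans_lt
    (isCompact_Icc.prod isCompact_Icc).measure_lt_top)
    (measurable_sqrt_gradSq v).aestronglyMeasurable C ?_
  filter_upwards [ae_restrict_mem (measurableSet_dom hφ)] with p hp
  rw [Real.norm_of_nonneg (Real.sqrt_nonneg _)]
  exact hC p hp.1 hp.2.1

lemma indicator_dom_slice {ε : ℝ} {φ : ℝ → ℝ} (hφ1 : ∀ y, φ y ≤ 1) (g : ℝ × ℝ → ℝ) :
    (fun y => ∫ x, (Dom ε φ).indicator g (x, y)) =
      (Ioo 0 ε).indicator fun y => ∫ x in φ y..1, g (x, y) := by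
  funext y
  by_cases hy : y ∈ Ioo 0 ε
  · rw [indicator_of_mem hy, intervalIntegral.integral_of_le (hφ1 y), integral_Ioc_eq_integral_Ioo,
      ← integral_indicator measurableSet_Ioo]
    congr 1
    funext x
    have : (x, y) ∈ Dom ε φ ↔ x ∈ Ioo (φ y) 1 :=
      ⟨fun h => ⟨h.1, h.2.1⟩, fun h => ⟨h.1, h.2, hy.1, hy.2⟩⟩
    simp only [indicator, this]
  · rw [indicator_of_notMem hy]
    have : ∀ x, (Dom ε φ).indicator g (x, y) = 0 := fun x =>
      indicator_of_notMem (fun h => hy ⟨h.2.2.1, h.2.2.2⟩) g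
    simp [this]

lemma integrableOn_integral_slice {ε : ℝ} {φ : ℝ → ℝ} (hφ : Continuous φ) (hφ1 : ∀ y, φ y ≤ 1)
    {g : ℝ × ℝ → ℝ} (hg : IntegrableOn g (Dom ε φ)) :
    IntegrableOn (fun y => ∫ x in φ y..1, g (x, y)) (Ioo 0 ε) := by
  rw [← integrable_indicator_iff (measurableSet_dom hφ), Measure.volume_eq_prod] at hg
  rw [← integrable_indicator_iff measurableSet_Ioo, ← indicator_dom_slice hφ1]
  exact hg.integral_prod_right

lemma setIntegral_dom_eq {ε : ℝ} {φ : ℝ → ℝ} (hφ : Continuous φ) (hφ1 : ∀ y, φ y ≤ 1)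
    {g : ℝ × ℝ → ℝ} (hg : IntegrableOn g (Dom ε φ)) :
    ∫ p in Dom ε φ, g p = ∫ y in Ioo 0 ε, ∫ x in φ y..1, g (x, y) := by
  rw [← integrable_indicator_iff (measurableSet_dom hφ), Measure.volume_eq_prod] at hg
  rw [← integral_indicator (measurableSet_dom hφ), Measure.volume_eq_prod, integral_prod_symm _ hg,
    indicator_dom_slice hφ1, integral_indicator measurableSet_Ioo]

lemma continuous_boundary_trace {ε : ℝ} {φ : ℝ → ℝ} (hφ : Continuous φ) (hφ1 : ∀ y, φ y ≤ 1)
    {v : ℝ × ℝ → ℝ} (hv : memV ε φ v) : Continuous fun y => v (φ y, y) := by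
  obtain ⟨K, hK⟩ := hv.1
  exact hK.continuousOn.comp_continuous (by fun_prop) fun y => ⟨le_rfl, hφ1 y⟩

/-- Translation estimate in the proof of Lemma 5.3: the translated function `T_δ v`
belongs to `V` and
`𝓔(v) − 𝓔(T_δ v) ≥ (1−ν)(1/ε)∫₀^ε ∫_{φ(y)}^{φ(y)+δ} √(1+|∇v|²) dx dy − δ`. -/
theorem translation_estimate
    (ε ν H : ℝ) (φ c : ℝ → ℝ) (hctx : Ctx ε ν H φ c)
    (v : ℝ × ℝ → ℝ) (hv : memV ε φ v)
    (δ : ℝ) (hδ : 0 < δ) (hδ1 : δ ≤ 1)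
    (Tv : ℝ × ℝ → ℝ)
    (hTv : ∀ p : ℝ × ℝ, Tv p = if p.1 ≤ 1 - δ then v (p.1 + δ, p.2) else 0) :
    memV ε φ Tv ∧
    En ε φ c v - En ε φ c Tv ≥
      (1 - ν) * ((1 / ε) * ∫ y in Ioo (0 : ℝ) ε,
        ∫ x in Ioo (φ y) (φ y + δ), Real.sqrt (1 + gradSq v (x, y))) - δ := by
  obtain ⟨⟨hε, -⟩, -, -, hφ1, -, hH, hφ0, hc, -, hν⟩ := hctx
  have hφ : Continuous φ := hφ1.continuous
  have hle1 : ∀ y, φ y ≤ 1 := fun y => (hφ0 y).trans zero_le_one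
  have hT : memV ε φ Tv := memV_translate hv hδ hTv
  refine ⟨hT, ?_⟩
  have hgv := integrableOn_dom hφ hH hv
  have hgT := integrableOn_dom hφ hH hT
  have hIv := integrableOn_integral_slice hφ hle1 hgv
  have hIT := integrableOn_integral_slice hφ hle1 hgT
  have hbd : ∀ {w : ℝ × ℝ → ℝ}, memV ε φ w →
      IntegrableOn (fun y => w (φ y, y) * c y * Real.sqrt (1 + (deriv φ y) ^ 2)) (Ioo 0 ε) := by
    intro w hw
    have hd : Continuous (deriv φ) := hφ1.continuous_deriv le_rfl
    have hcont : Continuous fun y => w (φ y, y) * c y * Real.sqrt (1 + (deriv φ y) ^ 2) :=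
      ((continuous_boundary_trace hφ hle1 hw).mul hc).mul (by fun_prop)
    exact (hcont.integrableOn_Icc (a := 0) (b := ε)).mono_set Ioo_subset_Icc_self
  have hslice : ∀ y, ∫ x in Ioo (φ y) (φ y + δ), Real.sqrt (1 + gradSq v (x, y)) =
      (∫ x in φ y..1, Real.sqrt (1 + gradSq v (x, y))) -
        (∫ x in φ y..1, Real.sqrt (1 + gradSq Tv (x, y))) + δ := fun y => by
    have h0 := hφ0 y
    rw [integral_slice_translate hφ hv hδ hTv (by linarith),
      ← intervalIntegral.integral_add_adjacent_intervals
        (intervalIntegrable_slice hφ hv le_rfl (by linarith) (by linarith : φ y + δ ≤ 1))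
        (intervalIntegrable_slice hφ hv (by linarith) (by linarith) le_rfl),
      ← integral_Ioc_eq_integral_Ioo, ← intervalIntegral.integral_of_le (by linarith)]
    ring
  have hIδ : IntegrableOn (fun y => ∫ x in Ioo (φ y) (φ y + δ), Real.sqrt (1 + gradSq v (x, y)))
      (Ioo 0 ε) := by
    simp only [hslice]
    exact (hIv.sub hIT).add (integrableOn_const (by simp))
  have hvol : (∫ p in Dom ε φ, Real.sqrt (1 + gradSq v p)) -
      (∫ p in Dom ε φ, Real.sqrt (1 + gradSq Tv p)) =
      (∫ y in Ioo 0 ε, ∫ x in Ioo (φ y) (φ y + δ), Real.sqrt (1 + gradSq v (x, y))) - ε * δ := by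
    rw [setIntegral_dom_eq hφ hle1 hgv, setIntegral_dom_eq hφ hle1 hgT, ← integral_sub hIv hIT]
    have : ∫ _ in Ioo 0 ε, δ = ε * δ := by simp [hε.le]
    rw [← this, ← integral_sub hIδ (integrableOn_const (by simp))]
    refine integral_congr_ae (ae_of_all _ fun y => ?_)
    simp only [hslice]
    ring
  have hbdry : (∫ y in Ioo 0 ε, v (φ y, y) * c y * Real.sqrt (1 + (deriv φ y) ^ 2)) -
      (∫ y in Ioo 0 ε, Tv (φ y, y) * c y * Real.sqrt (1 + (deriv φ y) ^ 2)) ≤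
      ν * ∫ y in Ioo 0 ε, ∫ x in Ioo (φ y) (φ y + δ), Real.sqrt (1 + gradSq v (x, y)) := by
    rw [← integral_sub (hbd hv) (hbd hT), ← integral_const_mul]
    refine integral_mono_ae ((hbd hv).sub (hbd hT)) (hIδ.const_mul ν) ?_
    filter_upwards [ae_restrict_of_ae (ae_abs_sub_le_integral_slice hφ hv)] with y hy
    have h0 := hφ0 y
    have hdiff := hy (φ y) (φ y + δ) le_rfl (by linarith) (by linarith)
    rw [intervalIntegral.integral_of_le (by linarith), integral_Ioc_eq_integral_Ioo] at hdiff
    have hTy : Tv (φ y, y) = v (φ y + δ, y) := by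
      rw [hTv, if_pos (by simp only; linarith)]
    simp only [hTy]
    calc v (φ y, y) * c y * Real.sqrt (1 + (deriv φ y) ^ 2) -
          v (φ y + δ, y) * c y * Real.sqrt (1 + (deriv φ y) ^ 2)
        = (v (φ y, y) - v (φ y + δ, y)) * (c y * Real.sqrt (1 + (deriv φ y) ^ 2)) := by ring
      _ ≤ |v (φ y, y) - v (φ y + δ, y)| * (|c y| * Real.sqrt (1 + (deriv φ y) ^ 2)) := by
        refine (le_abs_self _).trans_eq ?_
        rw [abs_mul, abs_mul, abs_of_nonneg (Real.sqrt_nonneg _)]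
      _ ≤ (∫ x in Ioo (φ y) (φ y + δ), Real.sqrt (1 + gradSq v (x, y))) * ν :=
        mul_le_mul hdiff (hν y) (by positivity) ((abs_nonneg _).trans hdiff)
      _ = _ := mul_comm _ _
  set I := ∫ y in Ioo 0 ε, ∫ x in Ioo (φ y) (φ y + δ), Real.sqrt (1 + gradSq v (x, y))
  have hE : En ε φ c v - En ε φ c Tv ≥ (1 / ε) * (I - ε * δ) - (1 / ε) * (ν * I) := by
    have := mul_le_mul_of_nonneg_left hbdry (one_div_pos.2 hε).le
    unfold En
    rw [← hvol]
    linarith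
  refine hE.le.trans_eq' ?_
  field_simp
  ring
end
end

section
/- (Boundary-average estimate (5.22) in the proof of Lemma 5.3) For every v ∈ V, (1/ε)∫₀^ε |v(φ(y),y) − v̄(0)| dy ≤ 2·(1/ε)∫₀^ε ∫_{φ(y)}^{ε} √(1+|∇v(x,y)|²) dx dy, where v̄(x) = (1/ε)∫₀^ε v(x,ŷ) dŷ is the y-average of v. -/
open MeasureTheory Set

noncomputable section

/-- A Lipschitz function on the line satisfies the fundamental theorem of calculus estimate. -/
lemma abs_sub_le_integral_abs_deriv {K : NNReal} {h : ℝ → ℝ} (hh : LipschitzWith K h)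
    {a b : ℝ} (hab : a ≤ b) : |h b - h a| ≤ ∫ x in Ioo a b, |deriv h x| := by
  rw [← (hh.lipschitzOnWith (s := uIcc a b)).absolutelyContinuousOnInterval.integral_deriv_eq_sub,
    ← integral_Ioc_eq_integral_Ioo, ← intervalIntegral.integral_of_le hab]
  exact intervalIntegral.abs_integral_le_integral_abs hab

/-- The value at `0` of a Lipschitz function differs from its mean over `(0, ε)` with density
`2x/ε²` by at most a weighted integral of its derivative. -/
lemma abs_sub_weighted_mean_le {K : NNReal} {h : ℝ → ℝ} (hh : LipschitzWith K h)
    {ε : ℝ} (hε : 0 < ε) :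
    |h 0 - ∫ x in Ioo 0 ε, 2 * x / ε ^ 2 * h x| ≤
      ∫ x in Ioo 0 ε, (1 - (x / ε) ^ 2) * |deriv h x| := by
  have hac := (hh.lipschitzOnWith (s := uIcc 0 ε)).absolutelyContinuousOnInterval
  have hw : ∀ x, HasDerivAt (fun x : ℝ => 1 - (x / ε) ^ 2) (-(2 * x / ε ^ 2)) x := by
    intro x
    have h1 := (((hasDerivAt_id x).div_const ε).pow 2).const_sub 1
    exact h1.congr_deriv (by simp only [id, Nat.cast_ofNat, Nat.reduceSub, pow_one]; field_simp)
  have hwC : ContDiff ℝ 1 (fun x : ℝ => 1 - (x / ε) ^ 2) := by fun_prop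
  obtain ⟨L, hL⟩ := hwC.contDiffOn.exists_lipschitzOnWith (s := uIcc 0 ε) (by simp)
    (convex_uIcc 0 ε) isCompact_uIcc
  have hibp := hL.absolutelyContinuousOnInterval.integral_mul_deriv_eq_deriv_mul hac
  have hd : deriv (fun x : ℝ => 1 - (x / ε) ^ 2) = fun x => -(2 * x / ε ^ 2) :=
    funext fun x => (hw x).deriv
  rw [hd] at hibp
  have hne : ε ≠ 0 := hε.ne'
  simp only [div_self hne, zero_div, neg_mul, intervalIntegral.integral_neg] at hibp
  have key : h 0 - ∫ x in (0 : ℝ)..ε, 2 * x / ε ^ 2 * h x =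
      - ∫ x in (0 : ℝ)..ε, (1 - (x / ε) ^ 2) * deriv h x := by
    rw [hibp]; ring
  rw [← integral_Ioc_eq_integral_Ioo, ← intervalIntegral.integral_of_le hε.le, key, abs_neg,
    ← integral_Ioc_eq_integral_Ioo, ← intervalIntegral.integral_of_le hε.le]
  refine (intervalIntegral.abs_integral_le_integral_abs hε.le).trans_eq ?_
  refine intervalIntegral.integral_congr fun x hx => ?_
  rw [uIcc_of_le hε.le] at hx
  have h1 : 0 ≤ x / ε := div_nonneg hx.1 hε.le
  have h2 : x / ε ≤ 1 := (div_le_one hε).2 hx.2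
  simp only [abs_mul]
  rw [abs_of_nonneg (by nlinarith)]

lemma measurable_pdx (g : ℝ × ℝ → ℝ) : Measurable (pdx g) :=
  measurable_fderiv_apply_const ℝ g _

lemma measurable_pdy (g : ℝ × ℝ → ℝ) : Measurable (pdy g) :=
  measurable_fderiv_apply_const ℝ g _

lemma measurable_gradSq (g : ℝ × ℝ → ℝ) : Measurable (gradSq g) :=
  ((measurable_pdx g).pow_const 2).add ((measurable_pdy g).pow_const 2)

lemma abs_pdx_le {K : NNReal} {g : ℝ × ℝ → ℝ} (hg : LipschitzWith K g) (p : ℝ × ℝ) :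
    |pdx g p| ≤ K := by
  refine ((fderiv ℝ g p).le_of_opNorm_le (norm_fderiv_le_of_lipschitz ℝ hg) _).trans ?_
  simp [Prod.norm_def]

lemma abs_pdy_le {K : NNReal} {g : ℝ × ℝ → ℝ} (hg : LipschitzWith K g) (p : ℝ × ℝ) :
    |pdy g p| ≤ K := by
  refine ((fderiv ℝ g p).le_of_opNorm_le (norm_fderiv_le_of_lipschitz ℝ hg) _).trans ?_
  simp [Prod.norm_def]

lemma sqrt_one_add_gradSq_le {K : NNReal} {g : ℝ × ℝ → ℝ} (hg : LipschitzWith K g) (p : ℝ × ℝ) :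
    |Real.sqrt (1 + gradSq g p)| ≤ Real.sqrt (1 + ((K : ℝ) ^ 2 + (K : ℝ) ^ 2)) := by
  rw [abs_of_nonneg (Real.sqrt_nonneg _)]
  refine Real.sqrt_le_sqrt ?_
  have h1 := sq_le_sq' (abs_le.1 (abs_pdx_le hg p)).1 (abs_le.1 (abs_pdx_le hg p)).2
  have h2 := sq_le_sq' (abs_le.1 (abs_pdy_le hg p)).1 (abs_le.1 (abs_pdy_le hg p)).2
  unfold gradSq
  linarith

lemma lipschitzWith_slice_fst {K : NNReal} {g : ℝ × ℝ → ℝ} (hg : LipschitzWith K g) (y : ℝ) :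
    LipschitzWith K (fun x => g (x, y)) := by
  have h := hg.comp (LipschitzWith.prodMk_right y)
  rwa [mul_one] at h

lemma lipschitzWith_slice_snd {K : NNReal} {g : ℝ × ℝ → ℝ} (hg : LipschitzWith K g) (x : ℝ) :
    LipschitzWith K (fun y => g (x, y)) := by
  have h := hg.comp (LipschitzWith.prodMk_left x)
  rwa [mul_one] at h

lemma deriv_slice_fst {g : ℝ × ℝ → ℝ} {x y : ℝ} (hg : DifferentiableAt ℝ g (x, y)) :
    deriv (fun t => g (t, y)) x = pdx g (x, y) :=
  (hg.hasFDerivAt.comp_hasDerivAt x ((hasDerivAt_id x).prodMk (hasDerivAt_const x y))).deriv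

lemma deriv_slice_snd {g : ℝ × ℝ → ℝ} {x y : ℝ} (hg : DifferentiableAt ℝ g (x, y)) :
    deriv (fun t => g (x, t)) y = pdy g (x, y) :=
  (hg.hasFDerivAt.comp_hasDerivAt y ((hasDerivAt_const y x).prodMk (hasDerivAt_id y))).deriv

/-- Almost every horizontal slice of a Lipschitz function has derivative `pdx` a.e. -/
lemma ae_deriv_slice_fst {K : NNReal} {g : ℝ × ℝ → ℝ} (hg : LipschitzWith K g) :
    ∀ᵐ y : ℝ, ∀ᵐ x : ℝ, deriv (fun t => g (t, y)) x = pdx g (x, y) := by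
  have h : ∀ᵐ p : ℝ × ℝ, DifferentiableAt ℝ g p := hg.ae_differentiableAt
  have h' : ∀ᵐ p : ℝ × ℝ, DifferentiableAt ℝ g p.swap :=
    (Measure.measurePreserving_swap (μ := (volume : Measure ℝ))
      (ν := (volume : Measure ℝ))).quasiMeasurePreserving.ae h
  filter_upwards [Measure.ae_ae_of_ae_prod h'] with y hy
  filter_upwards [hy] with x hx using deriv_slice_fst hx

/-- Almost every vertical slice of a Lipschitz function has derivative `pdy` a.e. -/
lemma ae_deriv_slice_snd {K : NNReal} {g : ℝ × ℝ → ℝ} (hg : LipschitzWith K g) :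
    ∀ᵐ x : ℝ, ∀ᵐ y : ℝ, deriv (fun t => g (x, t)) y = pdy g (x, y) := by
  have h : ∀ᵐ p : ℝ × ℝ, DifferentiableAt ℝ g p := hg.ae_differentiableAt
  filter_upwards [Measure.ae_ae_of_ae_prod h] with x hx
  filter_upwards [hx] with y hy using deriv_slice_snd hy

lemma ae_abs_sub_le_integral_pdx {K : NNReal} {g : ℝ × ℝ → ℝ} (hg : LipschitzWith K g) :
    ∀ᵐ y : ℝ, ∀ a b : ℝ, a ≤ b →
      |g (b, y) - g (a, y)| ≤ ∫ x in Ioo a b, |pdx g (x, y)| := by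
  filter_upwards [ae_deriv_slice_fst hg] with y hy a b hab
  refine (abs_sub_le_integral_abs_deriv (lipschitzWith_slice_fst hg y) hab).trans_eq ?_
  refine integral_congr_ae (ae_restrict_of_ae ?_)
  filter_upwards [hy] with x hx
  rw [hx]

lemma ae_abs_sub_le_integral_pdy {K : NNReal} {g : ℝ × ℝ → ℝ} (hg : LipschitzWith K g) :
    ∀ᵐ x : ℝ, ∀ a b : ℝ, a ≤ b →
      |g (x, b) - g (x, a)| ≤ ∫ y in Ioo a b, |pdy g (x, y)| := by
  filter_upwards [ae_deriv_slice_snd hg] with x hx a b hab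
  refine (abs_sub_le_integral_abs_deriv (lipschitzWith_slice_snd hg x) hab).trans_eq ?_
  refine integral_congr_ae (ae_restrict_of_ae ?_)
  filter_upwards [hx] with y hy
  rw [hy]

lemma ae_abs_sub_weighted_mean_le {K : NNReal} {g : ℝ × ℝ → ℝ} (hg : LipschitzWith K g)
    {ε : ℝ} (hε : 0 < ε) :
    ∀ᵐ y : ℝ, |g (0, y) - ∫ x in Ioo 0 ε, 2 * x / ε ^ 2 * g (x, y)| ≤
      ∫ x in Ioo 0 ε, (1 - (x / ε) ^ 2) * |pdx g (x, y)| := by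
  filter_upwards [ae_deriv_slice_fst hg] with y hy
  refine (abs_sub_weighted_mean_le (lipschitzWith_slice_fst hg y) hε).trans_eq ?_
  refine integral_congr_ae (ae_restrict_of_ae ?_)
  filter_upwards [hy] with x hx
  rw [hx]

/-- A bounded measurable function on the plane is integrable on bounded rectangles. -/
lemma integrable_rect_of_bound {f : ℝ × ℝ → ℝ} (hf : Measurable f) {C : ℝ} (hC : ∀ p, |f p| ≤ C)
    (a b c d : ℝ) :
    Integrable f ((volume.restrict (Ioo a b)).prod (volume.restrict (Ioo c d))) :=
  Integrable.of_bound hf.aestronglyMeasurable C (ae_of_all _ hC)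

lemma integrable_weighted_rect {ω : ℝ → ℝ} (hω : Continuous ω) {f : ℝ × ℝ → ℝ}
    (hf : Measurable f) {C : ℝ} (hC : ∀ p, |f p| ≤ C) {a b c d : ℝ} :
    Integrable (fun p => ω p.1 * f p)
      ((volume.restrict (Ioo a b)).prod (volume.restrict (Ioo c d))) :=
  ((hω.integrableOn_Icc.mono_set Ioo_subset_Icc_self).integrable.comp_fst _).mul_bdd
    hf.aestronglyMeasurable (ae_of_all _ hC)

lemma integrableOn_slice_fst_of_bound {f : ℝ × ℝ → ℝ} (hf : Measurable f) {C : ℝ}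
    (hC : ∀ p, |f p| ≤ C) (a b y : ℝ) : IntegrableOn (fun x => f (x, y)) (Ioo a b) :=
  Integrable.of_bound (hf.comp measurable_prodMk_right).aestronglyMeasurable C
    (ae_of_all _ fun _ => hC _)

lemma integrableOn_slice_snd_of_bound {f : ℝ × ℝ → ℝ} (hf : Measurable f) {C : ℝ}
    (hC : ∀ p, |f p| ≤ C) (a b x : ℝ) : IntegrableOn (fun y => f (x, y)) (Ioo a b) :=
  Integrable.of_bound (hf.comp measurable_prodMk_left).aestronglyMeasurable C
    (ae_of_all _ fun _ => hC _)

lemma weighted_abs_add_le_sqrt {s a b : ℝ} (h0 : 0 ≤ s) (h1 : s ≤ 1) :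
    (1 - s ^ 2) * |a| + s * |b| ≤ Real.sqrt (1 + (a ^ 2 + b ^ 2)) := by
  refine Real.le_sqrt_of_sq_le ?_
  rw [← sq_abs a, ← sq_abs b]
  have h2 : s ^ 2 * s ^ 2 ≤ s ^ 2 * 1 := by
    have : s ^ 2 ≤ 1 := by nlinarith
    gcongr
  nlinarith [sq_nonneg ((1 - s ^ 2) * |b| - s * |a|), sq_nonneg |a|, sq_nonneg |b|,
    mul_nonneg (sub_nonneg.2 h2) (sq_nonneg |a|), mul_nonneg (sub_nonneg.2 h2) (sq_nonneg |b|)]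

/-- Weighted means of two vertical positions differ by the weighted vertical variation. -/
lemma abs_weighted_mean_sub_le {K : NNReal} {g : ℝ × ℝ → ℝ} (hg : LipschitzWith K g)
    {ε : ℝ} {y z : ℝ} (hy : y ∈ Ioo 0 ε) (hz : z ∈ Ioo 0 ε) :
    |(∫ x in Ioo 0 ε, 2 * x / ε ^ 2 * g (x, y)) - ∫ x in Ioo 0 ε, 2 * x / ε ^ 2 * g (x, z)| ≤
      ∫ x in Ioo 0 ε, 2 * x / ε ^ 2 * ∫ t in Ioo 0 ε, |pdy g (x, t)| := by
  have hint : ∀ t, IntegrableOn (fun x => 2 * x / ε ^ 2 * g (x, t)) (Ioo 0 ε) := by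
    intro t
    have hc : Continuous fun x => g (x, t) := (lipschitzWith_slice_fst hg t).continuous
    have hw : Continuous fun x : ℝ => 2 * x / ε ^ 2 := by fun_prop
    exact (hw.mul hc).integrableOn_Icc.mono_set Ioo_subset_Icc_self
  have hB : Integrable (fun x => ∫ t in Ioo 0 ε, |pdy g (x, t)|) (volume.restrict (Ioo 0 ε)) :=
    (integrable_rect_of_bound (measurable_pdy g).abs
      (fun p => (abs_abs _).trans_le (abs_pdy_le hg p)) 0 ε 0 ε).integral_prod_left
  rw [← integral_sub (hint y) (hint z)]
  have hw : AEStronglyMeasurable (fun x : ℝ => 2 * x / ε ^ 2) (volume.restrict (Ioo 0 ε)) := by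
    fun_prop
  have hwB : Integrable (fun x => 2 * x / ε ^ 2 * ∫ t in Ioo 0 ε, |pdy g (x, t)|)
      (volume.restrict (Ioo 0 ε)) := by
    refine hB.bdd_mul (c := 2 * ε / ε ^ 2) hw ?_
    filter_upwards [ae_restrict_mem measurableSet_Ioo] with x hx
    have h0 : 0 ≤ 2 * x / ε ^ 2 := by have := hx.1; positivity
    rw [Real.norm_eq_abs, abs_of_nonneg h0]
    have := hx.2.le
    gcongr
  rw [← Real.norm_eq_abs]
  refine norm_integral_le_of_norm_le hwB ?_
  filter_upwards [ae_restrict_mem measurableSet_Ioo,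
    ae_restrict_of_ae (ae_abs_sub_le_integral_pdy hg)] with x hx hxy
  have h0 : 0 ≤ 2 * x / ε ^ 2 := by have := hx.1; positivity
  rw [← mul_sub, Real.norm_eq_abs, abs_mul, abs_of_nonneg h0]
  refine mul_le_mul_of_nonneg_left ?_ h0
  have hmono : ∀ a b, a ∈ Ioo 0 ε → b ∈ Ioo 0 ε →
      ∫ t in Ioo a b, |pdy g (x, t)| ≤ ∫ t in Ioo 0 ε, |pdy g (x, t)| := by
    intro a b ha hb
    refine setIntegral_mono_set (integrableOn_slice_snd_of_bound (measurable_pdy g).abs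
      (fun p => (abs_abs _).trans_le (abs_pdy_le hg p)) _ _ _)
      (ae_of_all _ fun _ => abs_nonneg _) ?_
    exact (Ioo_subset_Ioo ha.1.le hb.2.le).eventuallyLE
  rcases le_total y z with h | h
  · rw [abs_sub_comm]
    exact (hxy y z h).trans (hmono _ _ hy hz)
  · exact (hxy z y h).trans (hmono _ _ hz hy)

/-- The boundary-average estimate for a globally Lipschitz function. -/
lemma boundary_average_estimate_of_lipschitzWith {K : NNReal} {g : ℝ × ℝ → ℝ}
    (hg : LipschitzWith K g) {ε m : ℝ} (hε : 0 < ε) {φ : ℝ → ℝ} (hφ : Continuous φ)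
    (hm : ∀ y, m ≤ φ y) (hφ0 : ∀ y, φ y ≤ 0) :
    ∫ y in Ioo (0 : ℝ) ε, |g (φ y, y) - ybar ε g 0| ≤
      2 * ∫ y in Ioo (0 : ℝ) ε, ∫ x in Ioo (φ y) ε, Real.sqrt (1 + gradSq g (x, y)) := by
  set S : ℝ × ℝ → ℝ := fun p => Real.sqrt (1 + gradSq g p)
  have hSm : Measurable S := ((measurable_gradSq g).const_add 1).sqrt
  have hSb := sqrt_one_add_gradSq_le hg
  set G : ℝ → ℝ := fun y => ∫ x in Ioo 0 ε, 2 * x / ε ^ 2 * g (x, y) with hG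
  set Q : ℝ → ℝ := fun y => ∫ x in Ioo 0 ε, (1 - (x / ε) ^ 2) * |pdx g (x, y)| with hQ
  set R : ℝ := ∫ x in Ioo 0 ε, 2 * x / ε ^ 2 * ∫ t in Ioo 0 ε, |pdy g (x, t)| with hR
  set T : ℝ → ℝ := fun y => ∫ x in Ioo (φ y) ε, S (x, y) with hT
  set T₀ : ℝ → ℝ := fun y => ∫ x in Ioo 0 ε, S (x, y) with hT₀
  have hXb : ∀ p, |(|pdx g p|)| ≤ K := fun p => (abs_abs _).trans_le (abs_pdx_le hg p)
  have hYb : ∀ p, |(|pdy g p|)| ≤ K := fun p => (abs_abs _).trans_le (abs_pdy_le hg p)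
  have hQint : Integrable Q (volume.restrict (Ioo 0 ε)) :=
    (integrable_weighted_rect (ω := fun x => 1 - (x / ε) ^ 2) (by fun_prop)
      (measurable_pdx g).abs hXb).integral_prod_right
  have hT₀int : Integrable T₀ (volume.restrict (Ioo 0 ε)) :=
    (integrable_rect_of_bound hSm hSb 0 ε 0 ε).integral_prod_right
  have hTint : Integrable T (volume.restrict (Ioo 0 ε)) := by
    have hΩ : MeasurableSet {p : ℝ × ℝ | φ p.2 < p.1} :=
      measurableSet_lt (by fun_prop) (by fun_prop)
    have hI := ((integrable_rect_of_bound hSm hSb m ε 0 ε).indicator hΩ).integral_prod_right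
    refine hI.congr (ae_of_all _ fun y => ?_)
    have hset : Ioo (φ y) ε = Ioo m ε ∩ {x | φ y < x} := by
      ext x
      simp only [mem_Ioo, mem_inter_iff, mem_ofPred_eq]
      exact ⟨fun h => ⟨⟨(hm y).trans_lt h.1, h.2⟩, h.1⟩, fun h => ⟨h.2, h.1.2⟩⟩
    simp only [hT]
    have hlt : MeasurableSet {x | φ y < x} := measurableSet_Ioi
    rw [hset, ← setIntegral_indicator hlt]
    rfl
  have hRle : 2 * (∫ y in Ioo 0 ε, Q y) + ε * R ≤ 2 * ∫ y in Ioo 0 ε, T₀ y := by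
    set E : ℝ → ℝ := fun y => ∫ x in Ioo 0 ε, x / ε * |pdy g (x, y)| with hE
    have hEprod : Integrable (fun p : ℝ × ℝ => p.1 / ε * |pdy g p|)
        ((volume.restrict (Ioo 0 ε)).prod (volume.restrict (Ioo 0 ε))) :=
      integrable_weighted_rect (ω := fun x => x / ε) (by fun_prop) (measurable_pdy g).abs hYb
    have hEint : Integrable E (volume.restrict (Ioo 0 ε)) := hEprod.integral_prod_right
    have hRE : ε * R = 2 * ∫ y in Ioo 0 ε, E y := by
      have hswap := integral_integral_swap (f := fun x y => x / ε * |pdy g (x, y)|) hEprod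
      simp only [hE]
      rw [← hswap, hR, ← integral_const_mul, ← integral_const_mul]
      refine integral_congr_ae (ae_of_all _ fun x => ?_)
      simp only [integral_const_mul]
      field_simp
    rw [hRE, ← mul_add, ← integral_add hQint hEint]
    refine mul_le_mul_of_nonneg_left (integral_mono (hQint.add hEint) hT₀int fun y => ?_)
      zero_le_two
    have hQy : IntegrableOn (fun x => (1 - (x / ε) ^ 2) * |pdx g (x, y)|) (Ioo 0 ε) :=
      IntegrableOn.continuousOn_mul_of_subset (g := fun x => 1 - (x / ε) ^ 2) (K := Icc 0 ε) (by fun_prop)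
        (integrableOn_slice_fst_of_bound (measurable_pdx g).abs hXb 0 ε y)
        isCompact_Icc measurableSet_Ioo Ioo_subset_Icc_self
    have hEy : IntegrableOn (fun x => x / ε * |pdy g (x, y)|) (Ioo 0 ε) :=
      IntegrableOn.continuousOn_mul_of_subset (g := fun x => x / ε) (K := Icc 0 ε) (by fun_prop)
        (integrableOn_slice_fst_of_bound (measurable_pdy g).abs hYb 0 ε y)
        isCompact_Icc measurableSet_Ioo Ioo_subset_Icc_self
    simp only [hQ, hE, hT₀]
    rw [← integral_add hQy hEy]
    refine setIntegral_mono_on (hQy.add hEy)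
      (integrableOn_slice_fst_of_bound hSm hSb 0 ε y) measurableSet_Ioo fun x hx => ?_
    exact weighted_abs_add_le_sqrt (div_nonneg hx.1.le hε.le) ((div_le_one hε).2 hx.2.le)
  have hleft : ∀ y, ∫ x in Ioo (φ y) 0, |pdx g (x, y)| ≤ 2 * T y - 2 * T₀ y := by
    intro y
    have hSi := fun a b => integrableOn_slice_fst_of_bound hSm hSb a b y
    have hunion : T y = (∫ x in Ioo (φ y) 0, S (x, y)) + T₀ y := by
      rw [← integral_Ioc_eq_integral_Ioo, ← setIntegral_union
        (disjoint_left.2 fun x hx hx' => hx.2.not_gt hx'.1) measurableSet_Ioo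
        ((hSi (φ y) 1).mono_set fun x hx => ⟨hx.1, hx.2.trans_lt one_pos⟩) (hSi 0 ε),
        Ioc_union_Ioo_eq_Ioo (hφ0 y) hε]
    have hle : ∫ x in Ioo (φ y) 0, |pdx g (x, y)| ≤ ∫ x in Ioo (φ y) 0, S (x, y) :=
      integral_mono (integrableOn_slice_fst_of_bound (measurable_pdx g).abs hXb _ _ _)
        (hSi _ _) fun x => by
          have h := weighted_abs_add_le_sqrt (a := pdx g (x, y)) (b := pdy g (x, y))
            le_rfl zero_le_one
          simp only [ne_eq, OfNat.ofNat_ne_zero, not_false_eq_true, zero_pow, sub_zero, one_mul,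
            zero_mul, add_zero] at h
          exact h
    have hnn : 0 ≤ ∫ x in Ioo (φ y) 0, S (x, y) := integral_nonneg fun _ => Real.sqrt_nonneg _
    linarith
  have hmean : ∀ y ∈ Ioo 0 ε, |G y - ybar ε g 0| ≤ 1 / ε * (∫ z in Ioo 0 ε, Q z) + R := by
    intro y hy
    have hg0 : IntegrableOn (fun z => g (0, z)) (Ioo 0 ε) :=
      (lipschitzWith_slice_snd hg 0).continuous.integrableOn_Icc.mono_set Ioo_subset_Icc_self
    have hvol : volume.real (Ioo 0 ε) = ε := by simp [hε.le]
    have heq : G y - ybar ε g 0 = 1 / ε * ∫ z in Ioo 0 ε, (G y - g (0, z)) := by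
      rw [integral_sub (integrable_const _) hg0, setIntegral_const, hvol, ybar, smul_eq_mul]
      field_simp
    have hle : |∫ z in Ioo 0 ε, (G y - g (0, z))| ≤ ∫ z in Ioo 0 ε, (Q z + R) := by
      have hQR : Integrable (fun z => Q z + R) (volume.restrict (Ioo 0 ε)) :=
        hQint.add (integrable_const _)
      rw [← Real.norm_eq_abs]
      refine norm_integral_le_of_norm_le hQR ?_
      filter_upwards [ae_restrict_mem measurableSet_Ioo,
        ae_restrict_of_ae (ae_abs_sub_weighted_mean_le hg hε)] with z hz h
      have h1 := abs_weighted_mean_sub_le hg hy hz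
      have h2 := abs_sub_le (G y) (G z) (g (0, z))
      rw [abs_sub_comm] at h
      exact h2.trans ((add_le_add h1 h).trans_eq (add_comm _ _))
    rw [integral_add hQint (integrable_const _), setIntegral_const, hvol, smul_eq_mul] at hle
    rw [heq, abs_mul, abs_of_nonneg (by positivity : 0 ≤ 1 / ε)]
    refine (mul_le_mul_of_nonneg_left hle (by positivity)).trans_eq ?_
    field_simp
  have hpt : ∀ᵐ y ∂(volume.restrict (Ioo 0 ε)), |g (φ y, y) - ybar ε g 0| ≤
      (2 * T y - 2 * T₀ y) + Q y + (1 / ε * (∫ z in Ioo 0 ε, Q z) + R) := by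
    filter_upwards [ae_restrict_mem measurableSet_Ioo,
      ae_restrict_of_ae (ae_abs_sub_le_integral_pdx hg),
      ae_restrict_of_ae (ae_abs_sub_weighted_mean_le hg hε)] with y hy h1 h2
    have h3 := (h1 _ _ (hφ0 y)).trans (hleft y)
    have h4 := hmean y hy
    rw [abs_sub_comm] at h3
    have h5 := abs_sub_le (g (φ y, y)) (g (0, y)) (ybar ε g 0)
    have h6 := abs_sub_le (g (0, y)) (G y) (ybar ε g 0)
    linarith
  have hUint : Integrable (fun y => 2 * T y - 2 * T₀ y) (volume.restrict (Ioo 0 ε)) :=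
    (hTint.const_mul 2).sub (hT₀int.const_mul 2)
  have hUQint : Integrable (fun y => (2 * T y - 2 * T₀ y) + Q y) (volume.restrict (Ioo 0 ε)) :=
    hUint.add hQint
  have hsum : Integrable (fun y => (2 * T y - 2 * T₀ y) + Q y +
      (1 / ε * (∫ z in Ioo 0 ε, Q z) + R)) (volume.restrict (Ioo 0 ε)) :=
    hUQint.add (integrable_const _)
  refine (integral_mono_of_nonneg (ae_of_all _ fun _ => abs_nonneg _) hsum hpt).trans ?_
  have hval : ∫ y in Ioo 0 ε, ((2 * T y - 2 * T₀ y) + Q y +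
      (1 / ε * (∫ z in Ioo 0 ε, Q z) + R)) =
      (2 * (∫ y in Ioo 0 ε, T y) - 2 * ∫ y in Ioo 0 ε, T₀ y) +
        (2 * (∫ y in Ioo 0 ε, Q y) + ε * R) := by
    rw [integral_add hUQint (integrable_const _), integral_add hUint hQint,
      integral_sub (hTint.const_mul 2) (hT₀int.const_mul 2), integral_const_mul,
      integral_const_mul]
    simp only [integral_const, smul_eq_mul, measureReal_restrict_apply_univ, Real.volume_real_Ioo,
      sub_zero, max_eq_left hε.le]
    field_simp
    ring
  rw [hval]
  linarith

/-- Boundary-average estimate (5.22) in the proof of Lemma 5.3: for every `v ∈ V`,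
`(1/ε)∫₀^ε |v(φ(y),y) − v̄(0)| dy ≤ 2 (1/ε)∫₀^ε ∫_{φ(y)}^{ε} √(1+|∇v|²) dx dy`. -/
theorem boundary_average_estimate
    (ε ν H : ℝ) (φ c : ℝ → ℝ) (hctx : Ctx ε ν H φ c)
    (v : ℝ × ℝ → ℝ) (hv : memV ε φ v) :
    (1 / ε) * (∫ y in Ioo (0 : ℝ) ε, |v (φ y, y) - ybar ε v 0|) ≤
      2 * ((1 / ε) * ∫ y in Ioo (0 : ℝ) ε,
        ∫ x in Ioo (φ y) ε, Real.sqrt (1 + gradSq v (x, y))) := by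
  obtain ⟨⟨hε, hε1⟩, -, -, hφC, -, hm, hφ0, -⟩ := hctx
  obtain ⟨⟨K, hK⟩, -, -⟩ := hv
  obtain ⟨g, hg, hvg⟩ := hK.extend_real
  have hφ : Continuous φ := hφC.continuous
  have hbar : ybar ε v 0 = ybar ε g 0 := by
    unfold ybar
    congr 1
    exact integral_congr_ae (ae_of_all _ fun y => hvg ⟨hφ0 y, zero_le_one⟩)
  have hlhs : ∀ y, v (φ y, y) = g (φ y, y) := fun y =>
    hvg ⟨le_rfl, (hφ0 y).trans zero_le_one⟩
  have hopen : IsOpen {p : ℝ × ℝ | φ p.2 < p.1 ∧ p.1 < 1} :=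
    (isOpen_lt (hφ.comp continuous_snd) continuous_fst).inter
      (isOpen_lt continuous_fst continuous_const)
  have hgrad : ∀ y, ∀ x ∈ Ioo (φ y) ε, gradSq v (x, y) = gradSq g (x, y) := by
    intro y x hx
    have hev : v =ᶠ[nhds (x, y)] g := by
      filter_upwards [hopen.mem_nhds ⟨hx.1, hx.2.trans_le hε1⟩] with p hp
      exact hvg ⟨hp.1.le, hp.2.le⟩
    simp only [gradSq, pdx, pdy, hev.fderiv_eq]
  have hrhs : ∀ y, ∫ x in Ioo (φ y) ε, Real.sqrt (1 + gradSq v (x, y)) =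
      ∫ x in Ioo (φ y) ε, Real.sqrt (1 + gradSq g (x, y)) := fun y =>
    setIntegral_congr_fun measurableSet_Ioo fun x hx => by simp only [hgrad y x hx]
  simp only [hbar, hlhs, hrhs]
  have := boundary_average_estimate_of_lipschitzWith hg hε hφ hm hφ0
  rw [mul_left_comm]
  exact mul_le_mul_of_nonneg_left this (by positivity)
end
end
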